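/- arXiv:2007.10772 — 4 statements merged into one kernel-verified Lean document; each statement's English description precedes it below -/
import Mathlib

section
/- For every integer n ≥ 1, the assignment ρ_1 ↦ x_1, ρ_2 ↦ x_n x_1, ρ_3 ↦ x_{n−1} x_n x_1, …, ρ_n ↦ x_2 x_3 ⋯ x_n x_1 (that is, ρ_k ↦ x_{n−k+2} x_{n−k+3} ⋯ x_n x_1 for 2 ≤ k ≤ n) extends to a group isomorphism from the group with presentation ⟨ρ_1, …, ρ_n | ρ_1 ρ_n ρ_i = ρ_{i+1} ρ_n for 1 ≤ i ≤ n−1⟩ onto the group with presentation ⟨x_1, …, x_n | x_1 x_2 ⋯ x_n x_1 = x_2 x_3 ⋯ x_n x_1 x_2 = ⋯ = x_n x_1 x_2 ⋯ x_n⟩ (each side of these relations being a product of n+1 cyclically consecutive generators), with inverse determined by x_1 ↦ ρ_1 and x_{n+2−k} ↦ ρ_k ρ_{k−1}^{−1} for 2 ≤ k ≤ n. -/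
/-- The defining relators of the group with presentation
`⟨ρ_1, …, ρ_n | ρ_1 ρ_n ρ_i = ρ_{i+1} ρ_n for 1 ≤ i ≤ n-1⟩`, where the generator
`k : Fin n` represents `ρ_{k+1}`. -/
def MnGrpRels (n : ℕ) : Set (FreeGroup (Fin n)) :=
  { r | ∃ (i : ℕ) (h1 : 1 ≤ i) (h2 : i ≤ n - 1),
      r = FreeGroup.of ⟨1 - 1, by omega⟩ * FreeGroup.of ⟨n - 1, by omega⟩ *
            FreeGroup.of ⟨i - 1, by omega⟩ *
          (FreeGroup.of ⟨i + 1 - 1, by omega⟩ * FreeGroup.of ⟨n - 1, by omega⟩)⁻¹ }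

/-- The generator `ρ_i`, for `1 ≤ i ≤ n` (junk value `1` out of range). -/
def rhoG (n : ℕ) (i : ℕ) : PresentedGroup (MnGrpRels n) :=
  if h : 1 ≤ i ∧ i ≤ n then PresentedGroup.of ⟨i - 1, by omega⟩ else 1

/-- The word `x_{s+1} x_{s+2} ⋯ x_{s+n+1}` (indices taken cyclically modulo `n`, with the
generator `k : Fin n` representing `x_{k+1}`): a product of `n+1` cyclically consecutive
generators starting at `x_{s+1}`. -/
def cycWord (n : ℕ) (hn : 0 < n) (s : ℕ) : FreeGroup (Fin n) :=
  ((List.range (n + 1)).map (fun t => FreeGroup.of ⟨(s + t) % n, Nat.mod_lt _ hn⟩)).prod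

/-- The defining relators of the group with presentation
`⟨x_1, …, x_n | x_1 x_2 ⋯ x_n x_1 = x_2 x_3 ⋯ x_n x_1 x_2 = ⋯ = x_n x_1 x_2 ⋯ x_n⟩`,
equating the `n` cyclic products of `n+1` consecutive generators. -/
def CycRels (n : ℕ) : Set (FreeGroup (Fin n)) :=
  { r | ∃ (hn : 0 < n) (s : ℕ) (hs : s + 1 < n),
      r = cycWord n hn s * (cycWord n hn (s + 1))⁻¹ }

/-- The generator `x_k`, for `1 ≤ k ≤ n` (junk value `1` out of range). -/
def xG (n : ℕ) (k : ℕ) : PresentedGroup (CycRels n) :=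
  if h : 1 ≤ k ∧ k ≤ n then PresentedGroup.of ⟨k - 1, by omega⟩ else 1

def segP {G : Type*} [Group G] (X : ℕ → G) (s m : ℕ) : G :=
  ((List.range m).map (fun t => X (s + t))).prod

section seg
variable {G : Type*} [Group G] (X : ℕ → G)

theorem segP_zero (s : ℕ) : segP X s 0 = 1 := by simp [segP]

theorem segP_succ (s m : ℕ) : segP X s (m + 1) = segP X s m * X (s + m) := by
  simp [segP, List.range_succ]

theorem segP_succ_front (s m : ℕ) : segP X s (m + 1) = X s * segP X (s + 1) m := by
  induction m with
  | zero => simp [segP]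
  | succ m ih =>
    rw [segP_succ, ih, segP_succ, mul_assoc]
    congr 3
    omega

theorem segP_map {H : Type*} [Group H] (f : G →* H) (s m : ℕ) :
    f (segP X s m) = segP (fun t => f (X t)) s m := by
  induction m with
  | zero => simp [segP_zero]
  | succ m ih => simp only [segP_succ, map_mul, ih]

theorem segP_period (n : ℕ) (hX : ∀ t, X (t + n) = X t) (s m : ℕ) :
    segP X (s + n) m = segP X s m := by
  unfold segP
  congr 2
  funext t
  rw [← hX (s + t)]
  congr 1
  omega

theorem cyc_all (n : ℕ) (h0 : 0 < n) (hX : ∀ t, X (t + n) = X t)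
    (hW : ∀ s, s + 1 < n → segP X s (n + 1) = segP X (s + 1) (n + 1)) (s : ℕ) :
    segP X s (n + 1) = segP X 0 (n + 1) := by
  have h1 : ∀ s, s < n → segP X s (n + 1) = segP X 0 (n + 1) := by
    intro s
    induction s with
    | zero => intro _; rfl
    | succ s ih => intro h; rw [← hW s h, ih (by omega)]
  induction s using Nat.strong_induction_on with
  | _ s ih =>
    by_cases h : s < n
    · exact h1 s h
    · obtain ⟨u, rfl⟩ := Nat.exists_eq_add_of_le' (Nat.le_of_not_lt h)
      rw [segP_period X n hX, ih u (by omega)]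

theorem cyc_comm (n : ℕ) (h0 : 0 < n) (hX : ∀ t, X (t + n) = X t)
    (hW : ∀ s, s + 1 < n → segP X s (n + 1) = segP X (s + 1) (n + 1)) (s m : ℕ) :
    segP X 0 (n + 1) * segP X (s + 1) m = segP X s m * segP X 0 (n + 1) := by
  induction m with
  | zero => simp [segP_zero]
  | succ m ih =>
    have e1 := segP_succ X (s + m) (n + 1)
    rw [segP_succ_front, cyc_all X n h0 hX hW (s + m + 1), cyc_all X n h0 hX hW (s + m)] at e1
    have e2 : X (s + m + (n + 1)) = X (s + 1 + m) := by
      rw [← hX (s + 1 + m)]; congr 1; omega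
    rw [segP_succ X (s + 1) m, segP_succ X s m, ← mul_assoc, ih, mul_assoc, mul_assoc, e1, e2]

theorem cyc_rel (n : ℕ) (h0 : 0 < n) (hX : ∀ t, X (t + n) = X t)
    (hW : ∀ s, s + 1 < n → segP X s (n + 1) = segP X (s + 1) (n + 1)) (i : ℕ) (hi : i < n) :
    segP X n 1 * segP X 1 n * segP X (n + 1 - i) i = segP X (n - i) (i + 1) * segP X 1 n := by
  have hn : X n = X 0 := by simpa using hX 0
  have e : segP X n 1 * segP X 1 n = segP X 0 (n + 1) := by
    rw [segP_succ_front X 0 n, segP_succ, segP_zero]; simp [hn]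
  have ee : X n * segP X 1 n = segP X 0 (n + 1) := by
    rw [segP_succ_front X 0 n, hn]
  rw [e, segP_succ X (n - i) i, mul_assoc, show n - i + i = n by omega, ee,
    show n + 1 - i = n - i + 1 by omega]
  exact cyc_comm X n h0 hX hW _ _

/-- The converse direction: telescoping. -/
theorem tele (n : ℕ) (r : ℕ → G) (r0 : r 0 = 1)
    (hn : X n = r 1) (hX : ∀ j, 1 ≤ j → j < n → X j = r (n + 1 - j) * (r (n - j))⁻¹)
    (k : ℕ) (hk : k ≤ n) : segP X (n + 1 - k) k = r k := by
  induction k with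
  | zero => simp [segP_zero, r0]
  | succ k ih =>
    rw [segP_succ_front, show n + 1 - (k + 1) + 1 = n + 1 - k by omega, ih (by omega)]
    rcases Nat.eq_zero_or_pos k with rfl | h
    · simp [hn, r0]
    · rw [hX _ (by omega) (by omega), show n + 1 - (n + 1 - (k + 1)) = k + 1 by omega,
        show n - (n + 1 - (k + 1)) = k by omega]
      simp

theorem rel_cyc (n : ℕ) (h0 : 0 < n) (r : ℕ → G) (r0 : r 0 = 1)
    (hper : ∀ t, X (t + n) = X t)
    (h1 : X 0 = r 1) (hX : ∀ j, 1 ≤ j → j < n → X j = r (n + 1 - j) * (r (n - j))⁻¹)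
    (hr : ∀ i, 1 ≤ i → i < n → r 1 * r n * r i = r (i + 1) * r n) (s : ℕ) (hs : s < n) :
    segP X s (n + 1) = r 1 * r n := by
  have hn : X n = r 1 := by rw [← h1]; simpa using hper 0
  induction s with
  | zero =>
    have := tele X n r r0 hn hX n le_rfl
    rw [segP_succ_front, h1, ← this]
    congr 2
    omega
  | succ s ih =>
    have e := segP_succ X s (n + 1)
    rw [segP_succ_front, ih (by omega), show s + (n + 1) = s + 1 + n by omega, hper] at e
    have key : r 1 * r n * X (s + 1) = X s * (r 1 * r n) := by
      rw [hX (s + 1) (by omega) hs, show n + 1 - (s + 1) = n - s by omega]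
      have a2 := hr (n - (s + 1)) (by omega) (by omega)
      rw [show n - (s + 1) + 1 = n - s by omega] at a2
      rcases Nat.eq_zero_or_pos s with rfl | h
      · rw [h1]
        simp only [Nat.sub_zero, zero_add] at *
        have : r n * (r (n - 1))⁻¹ = (r n)⁻¹ * (r 1 * r n) := by
          rw [mul_inv_eq_iff_eq_mul, mul_assoc, a2]; group
        rw [this]; group
      · have a1 := hr (n - s) (by omega) (by omega)
        rw [show n - s + 1 = n + 1 - s by omega] at a1
        rw [hX s h (by omega), ← mul_assoc, a1, mul_inv_eq_iff_eq_mul, mul_assoc, a2]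
        group
    rw [key] at e
    exact mul_left_cancel e
end seg

def xN (n : ℕ) (h0 : 0 < n) (t : ℕ) : PresentedGroup (CycRels n) :=
  PresentedGroup.of ⟨t % n, Nat.mod_lt _ h0⟩

theorem xN_per (n : ℕ) (h0 : 0 < n) (t : ℕ) : xN n h0 (t + n) = xN n h0 t := by
  simp [xN]

theorem xG_eq (n : ℕ) (h0 : 0 < n) (k : ℕ) (h1 : 1 ≤ k) (h2 : k ≤ n) :
    xG n k = xN n h0 (k - 1) := by
  have : (k - 1) % n = k - 1 := Nat.mod_eq_of_lt (by omega)
  simp [xG, xN, h1, h2, this]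

theorem xN_rel (n : ℕ) (h0 : 0 < n) (s : ℕ) (hs : s + 1 < n) :
    segP (xN n h0) s (n + 1) = segP (xN n h0) (s + 1) (n + 1) := by
  have h : ∀ s, segP (xN n h0) s (n + 1) = PresentedGroup.mk (CycRels n) (cycWord n h0 s) := by
    intro s
    have := segP_map (fun t => FreeGroup.of (⟨t % n, Nat.mod_lt _ h0⟩ : Fin n))
      (PresentedGroup.mk (CycRels n)) s (n + 1)
    exact this.symm
  rw [h, h]
  apply PresentedGroup.mk_eq_mk_of_mul_inv_mem
  exact ⟨h0, s, hs, rfl⟩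

theorem rhoG_rel (n : ℕ) (i : ℕ) (h1 : 1 ≤ i) (hi : i < n) :
    rhoG n 1 * rhoG n n * rhoG n i = rhoG n (i + 1) * rhoG n n := by
  rw [rhoG, rhoG, rhoG, rhoG, dif_pos (by omega), dif_pos (by omega), dif_pos (by omega),
    dif_pos (by omega)]
  exact PresentedGroup.mk_eq_mk_of_mul_inv_mem ⟨i, h1, by omega, rfl⟩

theorem rhoG_zero (n : ℕ) : rhoG n 0 = 1 := by simp [rhoG]

def yN (n : ℕ) (j : ℕ) : PresentedGroup (MnGrpRels n) :=
  if j = 0 then rhoG n 1 else rhoG n (n + 1 - j) * (rhoG n (n - j))⁻¹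

theorem phi_rels (n : ℕ) (h0 : 0 < n) : ∀ r ∈ MnGrpRels n,
    FreeGroup.lift (fun k : Fin n => segP (xN n h0) (n - k.1) (k.1 + 1)) r = 1 := by
  rintro r ⟨i, h1, h2, rfl⟩
  rw [map_mul, map_inv, mul_inv_eq_one]
  simp only [map_mul, FreeGroup.lift_apply_of]
  have := cyc_rel (xN n h0) n h0 (xN_per n h0) (xN_rel n h0) i (by omega)
  simp only [Nat.sub_self, Nat.sub_zero, zero_add, Nat.add_sub_cancel]
  rw [show n - (n - 1) = 1 by omega, show n - 1 + 1 = n by omega, show i - 1 + 1 = i by omega,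
    show n - (i - 1) = n + 1 - i by omega]
  exact this

def phiH (n : ℕ) (h0 : 0 < n) : PresentedGroup (MnGrpRels n) →* PresentedGroup (CycRels n) :=
  PresentedGroup.toGroup (phi_rels n h0)

theorem phiH_rho (n : ℕ) (h0 : 0 < n) (k : ℕ) (hk : k ≤ n) :
    phiH n h0 (rhoG n k) = segP (xN n h0) (n + 1 - k) k := by
  rcases Nat.eq_zero_or_pos k with rfl | h
  · simp [rhoG_zero, segP_zero]
  · rw [rhoG, dif_pos ⟨h, hk⟩, phiH, PresentedGroup.toGroup.of]
    simp only
    rw [show n - (k - 1) = n + 1 - k by omega, show k - 1 + 1 = k by omega]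

theorem yN_seg (n : ℕ) (h0 : 0 < n) (s : ℕ) (hs : s < n) :
    segP (fun t => yN n (t % n)) s (n + 1) = rhoG n 1 * rhoG n n := by
  apply rel_cyc _ n h0 (rhoG n) (rhoG_zero n) _ _ _ (rhoG_rel n) s hs
  · intro t; simp
  · simp [yN]
  · intro j h1 h2
    simp only [Nat.mod_eq_of_lt h2]
    rw [yN, if_neg (by omega)]

theorem psi_rels (n : ℕ) : ∀ r ∈ CycRels n,
    FreeGroup.lift (fun j : Fin n => yN n j.1) r = 1 := by
  rintro r ⟨h0, s, hs, rfl⟩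
  have h : ∀ s, FreeGroup.lift (fun j : Fin n => yN n j.1) (cycWord n h0 s) =
      segP (fun t => yN n (t % n)) s (n + 1) := by
    intro s
    have := segP_map (fun t => FreeGroup.of (⟨t % n, Nat.mod_lt _ h0⟩ : Fin n))
      (FreeGroup.lift (fun j : Fin n => yN n j.1)) s (n + 1)
    simp only [FreeGroup.lift_apply_of] at this
    exact this
  rw [map_mul, map_inv, mul_inv_eq_one, h, h, yN_seg n h0 s (by omega), yN_seg n h0 _ hs]

def psiH (n : ℕ) : PresentedGroup (CycRels n) →* PresentedGroup (MnGrpRels n) :=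
  PresentedGroup.toGroup (psi_rels n)

theorem psiH_x (n : ℕ) (h0 : 0 < n) (t : ℕ) : psiH n (xN n h0 t) = yN n (t % n) := by
  rw [psiH, xN, PresentedGroup.toGroup.of]

theorem psi_phi (n : ℕ) (h0 : 0 < n) (k : ℕ) (hk : k ≤ n) :
    psiH n (phiH n h0 (rhoG n k)) = rhoG n k := by
  rw [phiH_rho n h0 k hk, segP_map]
  simp only [psiH_x]
  apply tele _ n (rhoG n) (rhoG_zero n) _ _ k hk
  · simp [yN]
  · intro j h1 h2
    simp only [Nat.mod_eq_of_lt h2]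
    rw [yN, if_neg (by omega)]

theorem phi_psi (n : ℕ) (h0 : 0 < n) (t : ℕ) (ht : t < n) :
    phiH n h0 (psiH n (xN n h0 t)) = xN n h0 t := by
  rw [psiH_x, Nat.mod_eq_of_lt ht, yN]
  split_ifs with h
  · subst h
    rw [phiH_rho n h0 1 h0]
    simpa [segP] using xN_per n h0 0
  · rw [map_mul, map_inv, phiH_rho n h0 _ (by omega), phiH_rho n h0 _ (by omega),
      mul_inv_eq_iff_eq_mul, show n + 1 - (n + 1 - t) = t by omega,
      show n + 1 - (n - t) = t + 1 by omega, show n + 1 - t = n - t + 1 by omega, segP_succ_front]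

def isoE (n : ℕ) (h0 : 0 < n) : PresentedGroup (MnGrpRels n) ≃* PresentedGroup (CycRels n) :=
  MonoidHom.toMulEquiv (phiH n h0) (psiH n)
    (by
      apply PresentedGroup.ext
      intro k
      have := psi_phi n h0 (k.1 + 1) k.2
      have e : rhoG n (k.1 + 1) = PresentedGroup.of k := by
        rw [rhoG, dif_pos ⟨by omega, k.2⟩]; rfl
      rw [e] at this
      exact this)
    (by
      apply PresentedGroup.ext
      intro k
      have := phi_psi n h0 k.1 k.2
      have e : xN n h0 k.1 = PresentedGroup.of k := by
        simp [xN, Nat.mod_eq_of_lt k.2]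
      rw [e] at this
      exact this)

/-- The assignment `ρ_1 ↦ x_1`, `ρ_k ↦ x_{n-k+2} x_{n-k+3} ⋯ x_n x_1` (for `2 ≤ k ≤ n`)
extends to a group isomorphism from `⟨ρ_1, …, ρ_n | ρ_1 ρ_n ρ_i = ρ_{i+1} ρ_n⟩` onto
`⟨x_1, …, x_n | x_1 x_2 ⋯ x_n x_1 = ⋯ = x_n x_1 x_2 ⋯ x_n⟩`, with inverse determined by
`x_1 ↦ ρ_1` and `x_{n+2-k} ↦ ρ_k ρ_{k-1}⁻¹` for `2 ≤ k ≤ n`. -/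
theorem stmt13 (n : ℕ) (hn : 1 ≤ n) :
    ∃ e : PresentedGroup (MnGrpRels n) ≃* PresentedGroup (CycRels n),
      e (rhoG n 1) = xG n 1 ∧
      (∀ k : ℕ, 2 ≤ k → k ≤ n →
        e (rhoG n k) =
          ((List.range (k - 1)).map (fun t => xG n (n - k + 2 + t))).prod * xG n 1) ∧
      e.symm (xG n 1) = rhoG n 1 ∧
      (∀ k : ℕ, 2 ≤ k → k ≤ n →
        e.symm (xG n (n + 2 - k)) = rhoG n k * (rhoG n (k - 1))⁻¹) := by
  refine ⟨isoE n hn, ?_, ?_, ?_, ?_⟩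
  · change phiH n hn (rhoG n 1) = _
    rw [phiH_rho n hn 1 hn, xG_eq n hn 1 le_rfl hn]
    simpa [segP] using xN_per n hn 0
  · intro k h2 hk
    change phiH n hn (rhoG n k) = _
    obtain ⟨m, rfl⟩ : ∃ m, k = m + 1 := ⟨k - 1, by omega⟩
    rw [phiH_rho n hn _ hk, segP_succ]
    congr 1
    · rw [segP]
      congr 1
      apply List.map_congr_left
      intro t ht
      have ht := List.mem_range.1 ht
      rw [xG_eq n hn _ (by omega) (by omega)]
      congr 1
      omega
    · rw [xG_eq n hn 1 le_rfl hn, show n + 1 - (m + 1) + m = 0 + n by omega, xN_per]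
  · change psiH n (xG n 1) = _
    rw [xG_eq n hn 1 le_rfl hn, psiH_x]
    simp [yN]
  · intro k h2 hk
    change psiH n (xG n (n + 2 - k)) = _
    rw [xG_eq n hn _ (by omega) (by omega), psiH_x, Nat.mod_eq_of_lt (by omega), yN,
      if_neg (by omega), show n + 1 - (n + 2 - k - 1) = k by omega,
      show n - (n + 2 - k - 1) = k - 1 by omega]
end

section
/- The group defined by the presentation with generators r_1, r_2, r_3 and relations r_1 r_3 r_1 = r_2 r_3, r_1 r_3 r_2 = r_3², and r_1² = 1 is isomorphic to the complex reflection group G_12, defined as the group with presentation ⟨s, t, u | s² = t² = u² = 1, stus = tust = ustu⟩. -/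
/-- The relators of the group presented by generators `r_1, r_2, r_3` (represented by
`0, 1, 2 : Fin 3`) and relations `r_1 r_3 r_1 = r_2 r_3`, `r_1 r_3 r_2 = r_3²`, `r_1² = 1`. -/
def RRels : Set (FreeGroup (Fin 3)) :=
  { FreeGroup.of 0 * FreeGroup.of 2 * FreeGroup.of 0 * (FreeGroup.of 1 * FreeGroup.of 2)⁻¹,
    FreeGroup.of 0 * FreeGroup.of 2 * FreeGroup.of 1 * (FreeGroup.of 2 ^ 2)⁻¹,
    FreeGroup.of 0 * FreeGroup.of 0 }

/-- The relators of the complex reflection group `G_12`, presented by generators `s, t, u`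
(represented by `0, 1, 2 : Fin 3`) and relations `s² = t² = u² = 1`,
`stus = tust = ustu`. -/
def G12Rels : Set (FreeGroup (Fin 3)) :=
  { FreeGroup.of 0 * FreeGroup.of 0,
    FreeGroup.of 1 * FreeGroup.of 1,
    FreeGroup.of 2 * FreeGroup.of 2,
    FreeGroup.of 0 * FreeGroup.of 1 * FreeGroup.of 2 * FreeGroup.of 0 *
      (FreeGroup.of 1 * FreeGroup.of 2 * FreeGroup.of 0 * FreeGroup.of 1)⁻¹,
    FreeGroup.of 1 * FreeGroup.of 2 * FreeGroup.of 0 * FreeGroup.of 1 *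
      (FreeGroup.of 2 * FreeGroup.of 0 * FreeGroup.of 1 * FreeGroup.of 2)⁻¹ }

theorem R_key {G : Type*} [Group G] {a b c : G}
    (hb : a * c * a = b * c) (hc : a * c * b = c ^ 2) : a * c * a * c * a = c ^ 3 := by
  have hb' : b = a * c * a * c⁻¹ := by rw [hb]; group
  calc a * c * a * c * a = (a * c * (a * c * a * c⁻¹)) * c := by group
    _ = c ^ 2 * c := by rw [← hb', hc]
    _ = c ^ 3 := by group

theorem R_tus {G : Type*} [Group G] {a c : G} (ha : a * a = 1)
    (k : a * c * a * c * a = c ^ 3) :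
    (c⁻¹ * a * c) * (a * c * a * c⁻¹ * a) * a = c := by
  calc _ = c⁻¹ * (a * c * a * c * a) * c⁻¹ * (a * a) := by group
    _ = c := by rw [k, ha]; group

theorem G_key {G : Type*} [Group G] {s t u : G}
    (h1 : s * t * u * s = t * u * s * t) (h2 : t * u * s * t = u * s * t * u) :
    s * (t * u * s) * (s * (t * u * s) * s * (t * u * s)⁻¹) = (t * u * s) ^ 2 := by
  rw [← mul_assoc, mul_inv_eq_iff_eq_mul]
  calc _ = (s * t * u * s) * (s * t * u * s) * s := by group
    _ = (t * u * s * t) * (u * s * t * u) * s := by rw [h1, h2]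
    _ = _ := by simp only [pow_two, mul_assoc]

/-- Two-sided data: the images of the generators in each direction. -/
def fGen {G : Type*} [Group G] (s t u : G) : Fin 3 → G :=
  ![s, s * (t * u * s) * s * (t * u * s)⁻¹, t * u * s]

def gGen {G : Type*} [Group G] (a c : G) : Fin 3 → G :=
  ![a, c⁻¹ * a * c, a * c * a * c⁻¹ * a]

/-- The group `⟨r_1, r_2, r_3 | r_1 r_3 r_1 = r_2 r_3, r_1 r_3 r_2 = r_3², r_1² = 1⟩` is
isomorphic to the complex reflection group
`G_12 = ⟨s, t, u | s² = t² = u² = 1, stus = tust = ustu⟩`. -/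
theorem stmt14 : Nonempty (PresentedGroup RRels ≃* PresentedGroup G12Rels) := by
  have rel {S : Set (FreeGroup (Fin 3))} (x : FreeGroup (Fin 3)) (hx : x ∈ S) :
      PresentedGroup.mk S x = 1 := PresentedGroup.one_of_mem hx
  -- relations in the first group
  obtain ⟨a, ea⟩ : ∃ a, a = PresentedGroup.of (rels := RRels) 0 := ⟨_, rfl⟩
  obtain ⟨b, eb⟩ : ∃ b, b = PresentedGroup.of (rels := RRels) 1 := ⟨_, rfl⟩
  obtain ⟨c, ec⟩ : ∃ c, c = PresentedGroup.of (rels := RRels) 2 := ⟨_, rfl⟩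
  obtain ⟨s, es⟩ : ∃ s, s = PresentedGroup.of (rels := G12Rels) 0 := ⟨_, rfl⟩
  obtain ⟨t, et⟩ : ∃ t, t = PresentedGroup.of (rels := G12Rels) 1 := ⟨_, rfl⟩
  obtain ⟨u, eu⟩ : ∃ u, u = PresentedGroup.of (rels := G12Rels) 2 := ⟨_, rfl⟩
  have ha : a * a = 1 := by
    rw [ea]; exact rel (S := RRels) _ (by simp [RRels])
  have hb : a * c * a = b * c := by
    rw [ea, eb, ec, ← mul_inv_eq_one]
    exact rel (S := RRels) _ (Or.inl rfl)
  have hc : a * c * b = c ^ 2 := by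
    rw [ea, eb, ec, ← mul_inv_eq_one]
    exact rel (S := RRels) _ (Or.inr (Or.inl rfl))
  have hs : s * s = 1 := by
    rw [es]; exact rel (S := G12Rels) _ (Or.inl rfl)
  have ht : t * t = 1 := by
    rw [et]; exact rel (S := G12Rels) _ (Or.inr (Or.inl rfl))
  have hu : u * u = 1 := by
    rw [eu]; exact rel (S := G12Rels) _ (Or.inr (Or.inr (Or.inl rfl)))
  have h1 : s * t * u * s = t * u * s * t := by
    rw [es, et, eu, ← mul_inv_eq_one]
    exact rel (S := G12Rels) _ (Or.inr (Or.inr (Or.inr (Or.inl rfl))))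
  have h2 : t * u * s * t = u * s * t * u := by
    rw [es, et, eu, ← mul_inv_eq_one]
    exact rel (S := G12Rels) _ (Or.inr (Or.inr (Or.inr (Or.inr rfl))))
  have k := R_key hb hc
  have tus := R_tus ha k
  have hai : a⁻¹ = a := inv_eq_of_mul_eq_one_left ha
  have hf : ∀ r ∈ RRels, FreeGroup.lift (fGen s t u) r = 1 := by
    rintro r (rfl | rfl | rfl)
    · simp [fGen, mul_assoc]
    · simp only [map_mul, map_inv, map_pow, FreeGroup.lift_apply_of]
      rw [mul_inv_eq_one]
      exact G_key h1 h2
    · simpa [fGen] using hs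
  have stus : a * (c⁻¹ * a * c) * (a * c * a * c⁻¹ * a) * a = a * c := by
    rw [mul_assoc a, mul_assoc a, tus]
  have tust : (c⁻¹ * a * c) * (a * c * a * c⁻¹ * a) * a * (c⁻¹ * a * c) = a * c := by
    rw [tus]; group
  have ustu : (a * c * a * c⁻¹ * a) * a * (c⁻¹ * a * c) * (a * c * a * c⁻¹ * a) = a * c := by
    calc _ = a * c * a * c⁻¹ * (a * a) * c⁻¹ * (a * c * a * c * a) * c⁻¹ * a := by group
      _ = a * c * a * c⁻¹ * 1 * c⁻¹ * c ^ 3 * c⁻¹ * a := by rw [k, ha]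
      _ = a * c * (a * a) := by group
      _ = a * c := by rw [ha, mul_one]
  have hg : ∀ r ∈ G12Rels, FreeGroup.lift (gGen a c) r = 1 := by
    rintro r (rfl | rfl | rfl | rfl | rfl) <;>
      simp only [map_mul, map_inv, FreeGroup.lift_apply_of]
    · exact ha
    · change c⁻¹ * a * c * (c⁻¹ * a * c) = 1
      calc _ = c⁻¹ * (a * a) * c := by group
        _ = 1 := by rw [ha]; group
    · change a * c * a * c⁻¹ * a * (a * c * a * c⁻¹ * a) = 1
      calc _ = a * c * a * c⁻¹ * (a * a) * c * a * c⁻¹ * a := by group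
        _ = a * c * a * c⁻¹ * 1 * c * a * c⁻¹ * a := by rw [ha]
        _ = a * c * (a * a) * c⁻¹ * a := by group
        _ = a * c * 1 * c⁻¹ * a := by rw [ha]
        _ = a * a := by group
        _ = 1 := ha
    · rw [mul_inv_eq_one]
      exact stus.trans tust.symm
    · rw [mul_inv_eq_one]
      exact tust.trans ustu.symm
  let F := PresentedGroup.toGroup hf
  let G := PresentedGroup.toGroup hg
  have Fa : F a = s := by rw [ea]; exact PresentedGroup.toGroup.of hf
  have Fb : F b = s * (t * u * s) * s * (t * u * s)⁻¹ := by
    rw [eb]; exact PresentedGroup.toGroup.of hf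
  have Fc : F c = t * u * s := by rw [ec]; exact PresentedGroup.toGroup.of hf
  have Gs : G s = a := by rw [es]; exact PresentedGroup.toGroup.of hg
  have Gt : G t = c⁻¹ * a * c := by rw [et]; exact PresentedGroup.toGroup.of hg
  have Gu : G u = a * c * a * c⁻¹ * a := by rw [eu]; exact PresentedGroup.toGroup.of hg
  have Gc : G (t * u * s) = c := by rw [map_mul, map_mul, Gs, Gt, Gu, tus]
  refine ⟨MonoidHom.toMulEquiv F G ?_ ?_⟩
  · apply PresentedGroup.ext
    intro i
    fin_cases i
    · change G (F (PresentedGroup.of 0)) = PresentedGroup.of 0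
      rw [← ea, Fa, Gs]
    · change G (F (PresentedGroup.of 1)) = PresentedGroup.of 1
      rw [← eb, Fb, map_mul, map_mul, map_mul, map_inv, Gc, Gs, hb]
      group
    · change G (F (PresentedGroup.of 2)) = PresentedGroup.of 2
      rw [← ec, Fc, Gc]
  · apply PresentedGroup.ext
    intro i
    fin_cases i
    · change F (G (PresentedGroup.of 0)) = PresentedGroup.of 0
      rw [← es, Gs, Fa]
    · change F (G (PresentedGroup.of 1)) = PresentedGroup.of 1
      rw [← et, Gt, map_mul, map_mul, map_inv, Fa, Fc, mul_assoc, inv_mul_eq_iff_eq_mul, ← h1]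
      group
    · change F (G (PresentedGroup.of 2)) = PresentedGroup.of 2
      rw [← eu, Gu]
      simp only [map_mul, map_inv, Fa, Fc]
      calc _ = (s * t * u * s) * s * (t * u * s)⁻¹ * s := by group
        _ = u * (s * s) := by rw [h1, h2]; group
        _ = u := by rw [hs, mul_one]
end

section
/- For every integer n ≥ 1, the assignment ρ_i ↦ σ_1 σ_2 ⋯ σ_i (for 1 ≤ i ≤ n) extends to a group isomorphism from the group defined by the presentation with generators ρ_1, …, ρ_n and relations ρ_1 ρ_j ρ_i = ρ_{i+1} ρ_j for all 1 ≤ i < j ≤ n, onto the braid group B_{n+1}. -/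
/-- The defining relators of the group with presentation
`⟨ρ_1, …, ρ_n | ρ_1 ρ_j ρ_i = ρ_{i+1} ρ_j for 1 ≤ i < j ≤ n⟩`, where the generator
`k : Fin n` represents `ρ_{k+1}`. -/
def HGrpRels (n : ℕ) : Set (FreeGroup (Fin n)) :=
  { r | ∃ (i j : ℕ) (hi : 1 ≤ i) (hij : i < j) (hj : j ≤ n),
      r = FreeGroup.of ⟨1 - 1, by omega⟩ * FreeGroup.of ⟨j - 1, by omega⟩ *
            FreeGroup.of ⟨i - 1, by omega⟩ *
          (FreeGroup.of ⟨i + 1 - 1, by omega⟩ * FreeGroup.of ⟨j - 1, by omega⟩)⁻¹ }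

/-- The generator `ρ_i`, for `1 ≤ i ≤ n` (junk value `1` out of range). -/
def rhoH (n : ℕ) (i : ℕ) : PresentedGroup (HGrpRels n) :=
  if h : 1 ≤ i ∧ i ≤ n then PresentedGroup.of ⟨i - 1, by omega⟩ else 1

/-- The defining relators of the braid group `B_{n+1}` on `n+1` strands: the generator
`k : Fin n` represents `σ_{k+1}`, and the relations are
`σ_i σ_{i+1} σ_i = σ_{i+1} σ_i σ_{i+1}` for `1 ≤ i < n` and `σ_i σ_j = σ_j σ_i` for
`|i - j| > 1`. -/
def BraidRels (n : ℕ) : Set (FreeGroup (Fin n)) :=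
  { r | (∃ (i : ℕ) (h1 : 1 ≤ i) (h2 : i < n),
          r = FreeGroup.of ⟨i - 1, by omega⟩ * FreeGroup.of ⟨i + 1 - 1, by omega⟩ *
                FreeGroup.of ⟨i - 1, by omega⟩ *
              (FreeGroup.of ⟨i + 1 - 1, by omega⟩ * FreeGroup.of ⟨i - 1, by omega⟩ *
                FreeGroup.of ⟨i + 1 - 1, by omega⟩)⁻¹) ∨
        (∃ (i j : ℕ) (hi1 : 1 ≤ i) (hi2 : i ≤ n) (hj1 : 1 ≤ j) (hj2 : j ≤ n),
          (i + 1 < j ∨ j + 1 < i) ∧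
          r = FreeGroup.of ⟨i - 1, by omega⟩ * FreeGroup.of ⟨j - 1, by omega⟩ *
              (FreeGroup.of ⟨j - 1, by omega⟩ * FreeGroup.of ⟨i - 1, by omega⟩)⁻¹) }

/-- The braid group on `n+1` strands, as a presented group. -/
abbrev Braid (n : ℕ) := PresentedGroup (BraidRels n)

/-- The Artin generator `σ_k` of the braid group `B_{n+1}`, for `1 ≤ k ≤ n`
(junk value `1` out of range). -/
def sigmaB (n : ℕ) (k : ℕ) : Braid n :=
  if h : 1 ≤ k ∧ k ≤ n then PresentedGroup.of ⟨k - 1, by omega⟩ else 1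

/-- The product `σ_1 σ_2 ⋯ σ_i` in the braid group `B_{n+1}`. -/
def Sprod (n : ℕ) (i : ℕ) : Braid n :=
  ((List.range i).map (fun t => sigmaB n (t + 1))).prod

theorem aux_comm {G : Type*} [Group G] (n : ℕ) (s r : ℕ → G) (h0 : r 0 = 1)
    (hr : ∀ i, r (i + 1) = r i * s (i + 1))
    (hc : ∀ i j, 1 ≤ i → i + 1 < j → j ≤ n → s i * s j = s j * s i)
    (m k : ℕ) (hmk : m + 1 < k) (hk : k ≤ n) : r m * s k = s k * r m := by
  induction m with
  | zero => simp [h0]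
  | succ m ih =>
    rw [hr, mul_assoc, hc (m + 1) k (by omega) hmk hk, ← mul_assoc, ih (by omega), mul_assoc]

theorem aux_shift {G : Type*} [Group G] (n : ℕ) (s r : ℕ → G) (h0 : r 0 = 1)
    (hr : ∀ i, r (i + 1) = r i * s (i + 1))
    (hb : ∀ i, 1 ≤ i → i < n → s i * s (i + 1) * s i = s (i + 1) * s i * s (i + 1))
    (hc : ∀ i j, 1 ≤ i → i + 1 < j → j ≤ n → s i * s j = s j * s i)
    (k j : ℕ) (h1 : 1 ≤ k) (hk : k < j) (hj : j ≤ n) : r j * s k = s (k + 1) * r j := by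
  induction j with
  | zero => omega
  | succ j ih =>
    rcases Nat.lt_or_ge k j with h | h
    · rw [hr, mul_assoc, ← hc k (j + 1) h1 (by omega) hj, ← mul_assoc, ih h (by omega), mul_assoc]
    · obtain rfl : k = j := by omega
      obtain ⟨m, rfl⟩ : ∃ m, k = m + 1 := ⟨k - 1, by omega⟩
      have hb' := hb (m + 1) h1 (by omega)
      have hcm := aux_comm n s r h0 hr hc m (m + 1 + 1) (by omega) hj
      calc r (m + 1 + 1) * s (m + 1)
          = r m * (s (m + 1) * s (m + 1 + 1) * s (m + 1)) := by
            rw [hr, hr]; simp only [mul_assoc]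
        _ = (r m * s (m + 1 + 1)) * (s (m + 1) * s (m + 1 + 1)) := by
            rw [hb']; simp only [mul_assoc]
        _ = s (m + 1 + 1) * r (m + 1 + 1) := by
            rw [hcm, hr, hr]; simp only [mul_assoc]

theorem aux_forward {G : Type*} [Group G] (n : ℕ) (s r : ℕ → G) (h0 : r 0 = 1)
    (hr : ∀ i, r (i + 1) = r i * s (i + 1))
    (hb : ∀ i, 1 ≤ i → i < n → s i * s (i + 1) * s i = s (i + 1) * s i * s (i + 1))
    (hc : ∀ i j, 1 ≤ i → i + 1 < j → j ≤ n → s i * s j = s j * s i)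
    (i j : ℕ) (hij : i < j) (hj : j ≤ n) : r 1 * r j * r i = r (i + 1) * r j := by
  induction i with
  | zero => simp [h0]
  | succ i ih =>
    rw [hr i, ← mul_assoc, ih (by omega), mul_assoc,
      aux_shift n s r h0 hr hb hc (i + 1) j (by omega) hij hj, ← mul_assoc, ← hr]

theorem aux_bshift {G : Type*} [Group G] (n : ℕ) (s r : ℕ → G) (h0 : r 0 = 1)
    (hr : ∀ i, r (i + 1) = r i * s (i + 1))
    (hH : ∀ i j, 1 ≤ i → i < j → j ≤ n → r 1 * r j * r i = r (i + 1) * r j)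
    (k j : ℕ) (h1 : 1 ≤ k) (hk : k < j) (hj : j ≤ n) : r j * s k = s (k + 1) * r j := by
  obtain ⟨m, rfl⟩ : ∃ m, k = m + 1 := ⟨k - 1, by omega⟩
  have e1 : r 1 * r j * r m = r (m + 1) * r j := by
    rcases Nat.eq_zero_or_pos m with rfl | h
    · simp [h0]
    · exact hH m j h (by omega) hj
  have e2 := hH (m + 1) j h1 hk hj
  rw [hr m, ← mul_assoc, e1, hr (m + 1), mul_assoc, mul_assoc] at e2
  exact mul_left_cancel e2

theorem aux_bcomm {G : Type*} [Group G] (n : ℕ) (s r : ℕ → G)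
    (hr : ∀ i, r (i + 1) = r i * s (i + 1))
    (hS : ∀ k j, 1 ≤ k → k < j → j ≤ n → r j * s k = s (k + 1) * r j)
    (i j : ℕ) (hi : 1 ≤ i) (hij : i + 1 < j) (hj : j ≤ n) : s i * s j = s j * s i := by
  obtain ⟨m, rfl⟩ : ∃ m, j = m + 1 := ⟨j - 1, by omega⟩
  have e1 := hS i (m + 1) hi (by omega) hj
  rw [hr, ← mul_assoc, ← hS i m hi (by omega) (by omega), mul_assoc, mul_assoc] at e1
  exact (mul_left_cancel e1).symm

theorem aux_bbraid {G : Type*} [Group G] (n : ℕ) (s r : ℕ → G) (h0 : r 0 = 1)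
    (hr : ∀ i, r (i + 1) = r i * s (i + 1))
    (hS : ∀ k j, 1 ≤ k → k < j → j ≤ n → r j * s k = s (k + 1) * r j)
    (i : ℕ) (hi : 1 ≤ i) (hn : i < n) :
    s i * s (i + 1) * s i = s (i + 1) * s i * s (i + 1) := by
  obtain ⟨m, rfl⟩ : ∃ m, i = m + 1 := ⟨i - 1, by omega⟩
  have hcm := aux_comm n s r h0 hr (aux_bcomm n s r hr hS) m (m + 1 + 1) (by omega) hn
  have e1 := hS (m + 1) (m + 1 + 1) hi (by omega) hn
  rw [hr (m + 1), hr m] at e1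
  apply mul_left_cancel (a := r m)
  calc r m * (s (m + 1) * s (m + 1 + 1) * s (m + 1))
      = s (m + 1 + 1) * (r m * s (m + 1) * s (m + 1 + 1)) := by
        rw [← e1]; simp only [mul_assoc]
    _ = (s (m + 1 + 1) * r m) * (s (m + 1) * s (m + 1 + 1)) := by simp only [mul_assoc]
    _ = _ := by rw [← hcm]; simp only [mul_assoc]

theorem sigmaB_eq (n k : ℕ) (h1 : 1 ≤ k) (h2 : k ≤ n) :
    sigmaB n k = PresentedGroup.of ⟨k - 1, by omega⟩ := by
  simp [sigmaB, h1, h2]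

theorem rhoH_eq (n k : ℕ) (h1 : 1 ≤ k) (h2 : k ≤ n) :
    rhoH n k = PresentedGroup.of ⟨k - 1, by omega⟩ := by
  simp [rhoH, h1, h2]

theorem Sprod_zero (n : ℕ) : Sprod n 0 = 1 := by simp [Sprod]

theorem Sprod_succ (n i : ℕ) : Sprod n (i + 1) = Sprod n i * sigmaB n (i + 1) := by
  simp [Sprod, List.range_succ]

theorem sigmaB_braid (n i : ℕ) (h1 : 1 ≤ i) (h2 : i < n) :
    sigmaB n i * sigmaB n (i + 1) * sigmaB n i =
      sigmaB n (i + 1) * sigmaB n i * sigmaB n (i + 1) := by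
  rw [sigmaB_eq n i h1 h2.le, sigmaB_eq n (i + 1) (by omega) h2]
  rw [← mul_inv_eq_one]
  exact PresentedGroup.one_of_mem (rels := BraidRels n) (Or.inl ⟨i, h1, h2, rfl⟩)

theorem sigmaB_comm (n i j : ℕ) (h1 : 1 ≤ i) (h : i + 1 < j) (h2 : j ≤ n) :
    sigmaB n i * sigmaB n j = sigmaB n j * sigmaB n i := by
  rw [sigmaB_eq n i h1 (by omega), sigmaB_eq n j (by omega) h2]
  rw [← mul_inv_eq_one]
  exact PresentedGroup.one_of_mem (rels := BraidRels n)
    (Or.inr ⟨i, j, h1, by omega, by omega, h2, Or.inl h, rfl⟩)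

theorem rhoH_rel (n i j : ℕ) (h1 : 1 ≤ i) (h : i < j) (h2 : j ≤ n) :
    rhoH n 1 * rhoH n j * rhoH n i = rhoH n (i + 1) * rhoH n j := by
  rw [rhoH_eq n i h1 (by omega), rhoH_eq n j (by omega) h2, rhoH_eq n 1 le_rfl (by omega),
    rhoH_eq n (i + 1) (by omega) (by omega)]
  rw [← mul_inv_eq_one]
  exact PresentedGroup.one_of_mem (rels := HGrpRels n) ⟨i, j, h1, h, h2, rfl⟩

/-- The candidate images of the Artin generators. -/
def tauH (n k : ℕ) : PresentedGroup (HGrpRels n) := (rhoH n (k - 1))⁻¹ * rhoH n k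

theorem rhoH_zero (n : ℕ) : rhoH n 0 = 1 := by simp [rhoH]

theorem rhoH_succ (n i : ℕ) : rhoH n (i + 1) = rhoH n i * tauH n (i + 1) := by
  simp [tauH]

theorem tauH_shift (n k j : ℕ) (h1 : 1 ≤ k) (hk : k < j) (hj : j ≤ n) :
    rhoH n j * tauH n k = tauH n (k + 1) * rhoH n j :=
  aux_bshift n (tauH n) (rhoH n) (rhoH_zero n) (rhoH_succ n) (rhoH_rel n) k j h1 hk hj

theorem fwd_rels (n : ℕ) : ∀ r ∈ HGrpRels n,
    FreeGroup.lift (fun k : Fin n => Sprod n (k + 1)) r = 1 := by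
  rintro r ⟨i, j, hi, hij, hj, rfl⟩
  have h := aux_forward n (sigmaB n) (Sprod n) (Sprod_zero n) (Sprod_succ n)
    (sigmaB_braid n) (sigmaB_comm n) i j hij hj
  obtain ⟨a, rfl⟩ : ∃ a, i = a + 1 := ⟨i - 1, by omega⟩
  obtain ⟨b, rfl⟩ : ∃ b, j = b + 1 := ⟨j - 1, by omega⟩
  rw [map_mul, map_inv, mul_inv_eq_one]
  simpa only [map_mul, FreeGroup.lift_apply_of, Nat.add_sub_cancel, Nat.sub_self, Nat.zero_add] using h

theorem bwd_rels (n : ℕ) : ∀ r ∈ BraidRels n,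
    FreeGroup.lift (fun k : Fin n => tauH n (k + 1)) r = 1 := by
  rintro r (⟨i, hi, hn, rfl⟩ | ⟨i, j, hi, hi2, hj, hj2, hij, rfl⟩)
  · have h := aux_bbraid n (tauH n) (rhoH n) (rhoH_zero n) (rhoH_succ n) (tauH_shift n) i hi hn
    obtain ⟨a, rfl⟩ : ∃ a, i = a + 1 := ⟨i - 1, by omega⟩
    rw [map_mul, map_inv, mul_inv_eq_one]
    simpa only [map_mul, FreeGroup.lift_apply_of, Nat.add_sub_cancel, Nat.sub_self, Nat.zero_add] using h
  · have h : tauH n i * tauH n j = tauH n j * tauH n i := by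
      rcases hij with h | h
      · exact aux_bcomm n (tauH n) (rhoH n) (rhoH_succ n) (tauH_shift n) i j hi h hj2
      · exact (aux_bcomm n (tauH n) (rhoH n) (rhoH_succ n) (tauH_shift n) j i hj h hi2).symm
    obtain ⟨a, rfl⟩ : ∃ a, i = a + 1 := ⟨i - 1, by omega⟩
    obtain ⟨b, rfl⟩ : ∃ b, j = b + 1 := ⟨j - 1, by omega⟩
    rw [map_mul, map_inv, mul_inv_eq_one]
    simpa only [map_mul, FreeGroup.lift_apply_of, Nat.add_sub_cancel, Nat.sub_self, Nat.zero_add] using h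

/-- The homomorphism sending each `ρ_i` to `σ_1 ⋯ σ_i`. -/
def fwdHom (n : ℕ) : PresentedGroup (HGrpRels n) →* Braid n :=
  PresentedGroup.toGroup (fwd_rels n)

/-- The inverse homomorphism. -/
def bwdHom (n : ℕ) : Braid n →* PresentedGroup (HGrpRels n) :=
  PresentedGroup.toGroup (bwd_rels n)

theorem fwdHom_rho (n i : ℕ) (hi : i ≤ n) : fwdHom n (rhoH n i) = Sprod n i := by
  rcases i with _ | i
  · rw [rhoH_zero, Sprod_zero, map_one]
  · rw [rhoH_eq n _ (by omega) hi]
    exact PresentedGroup.toGroup.of (fwd_rels n)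

theorem bwdHom_sigma (n i : ℕ) (h1 : 1 ≤ i) (hi : i ≤ n) :
    bwdHom n (sigmaB n i) = tauH n i := by
  obtain ⟨a, rfl⟩ : ∃ a, i = a + 1 := ⟨i - 1, by omega⟩
  rw [sigmaB_eq n _ h1 hi]
  exact PresentedGroup.toGroup.of (bwd_rels n)

theorem bwdHom_Sprod (n i : ℕ) (hi : i ≤ n) : bwdHom n (Sprod n i) = rhoH n i := by
  induction i with
  | zero => rw [rhoH_zero, Sprod_zero, map_one]
  | succ i ih =>
    rw [Sprod_succ, map_mul, ih (by omega), bwdHom_sigma n _ (by omega) hi, ← rhoH_succ]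

theorem bwd_fwd (n : ℕ) : (bwdHom n).comp (fwdHom n) = MonoidHom.id _ := by
  apply PresentedGroup.ext
  intro x
  have e : PresentedGroup.of x = rhoH n (x + 1) := (rhoH_eq n (x + 1) (by omega) x.2).symm
  rw [e, MonoidHom.comp_apply, fwdHom_rho n _ x.2, bwdHom_Sprod n _ x.2, MonoidHom.id_apply]

theorem fwd_bwd (n : ℕ) : (fwdHom n).comp (bwdHom n) = MonoidHom.id _ := by
  apply PresentedGroup.ext
  intro x
  have e : PresentedGroup.of x = sigmaB n (x + 1) := (sigmaB_eq n (x + 1) (by omega) x.2).symm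
  rw [e, MonoidHom.comp_apply, bwdHom_sigma n _ (by omega) x.2, MonoidHom.id_apply, tauH,
    map_mul, map_inv, fwdHom_rho n _ x.2, fwdHom_rho n _ (by omega), Sprod_succ]
  simp

/-- The assignment `ρ_i ↦ σ_1 σ_2 ⋯ σ_i` extends to a group isomorphism from the group
`⟨ρ_1, …, ρ_n | ρ_1 ρ_j ρ_i = ρ_{i+1} ρ_j for 1 ≤ i < j ≤ n⟩` onto the braid group
`B_{n+1}`. -/
theorem stmt15 (n : ℕ) (hn : 1 ≤ n) :
    ∃ e : PresentedGroup (HGrpRels n) ≃* Braid n,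
      ∀ i : ℕ, 1 ≤ i → i ≤ n → e (rhoH n i) = Sprod n i := by
  exact ⟨MonoidHom.toMulEquiv (fwdHom n) (bwdHom n) (bwd_fwd n) (fwd_bwd n),
    fun i _ hi => fwdHom_rho n i hi⟩
end

section
/- For every odd integer m ≥ 3, the assignment ρ_1 ↦ σ, ρ_2 ↦ σ τ extends to a group isomorphism from the group B(m) defined by the presentation with generators ρ_1, ρ_2 and the single relation ρ_1 ρ_2^{(m−1)/2} ρ_1 = ρ_2^{(m+1)/2} onto the dihedral Artin–Tits group B(I_2(m)), defined as the group with generators σ, τ and the single braid relation (στ)^{(m−1)/2} σ = (τσ)^{(m−1)/2} τ (the alternating products of length m starting with σ and with τ respectively being equal). -/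
/-- The relator of the group `B(m) = ⟨ρ_1, ρ_2 | ρ_1 ρ_2^{(m-1)/2} ρ_1 = ρ_2^{(m+1)/2}⟩`,
where `0 : Fin 2` represents `ρ_1` and `1 : Fin 2` represents `ρ_2`. -/
def BmRels (m : ℕ) : Set (FreeGroup (Fin 2)) :=
  { FreeGroup.of 0 * FreeGroup.of 1 ^ ((m - 1) / 2) * FreeGroup.of 0 *
      (FreeGroup.of 1 ^ ((m + 1) / 2))⁻¹ }

/-- The relator of the dihedral Artin–Tits group
`B(I_2(m)) = ⟨σ, τ | (στ)^{(m-1)/2} σ = (τσ)^{(m-1)/2} τ⟩` (for odd `m`, the two alternating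
products of length `m` starting with `σ` and with `τ` respectively are equal), where
`0 : Fin 2` represents `σ` and `1 : Fin 2` represents `τ`. -/
def DihedralArtinRels (m : ℕ) : Set (FreeGroup (Fin 2)) :=
  { (FreeGroup.of 0 * FreeGroup.of 1) ^ ((m - 1) / 2) * FreeGroup.of 0 *
      ((FreeGroup.of 1 * FreeGroup.of 0) ^ ((m - 1) / 2) * FreeGroup.of 1)⁻¹ }

theorem aux_pow {G : Type*} [Group G] (s t : G) (k : ℕ) :
    (s * t) ^ (k + 1) = s * ((t * s) ^ k * t) := by
  induction k with
  | zero => simp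
  | succ n ih => rw [pow_succ', ih, pow_succ' (t * s)]; simp only [mul_assoc]

theorem aux_iff {G : Type*} [Group G] (s t : G) (k : ℕ) :
    s * (s * t) ^ k * s = (s * t) ^ (k + 1) ↔ (s * t) ^ k * s = (t * s) ^ k * t := by
  rw [aux_pow, mul_assoc, mul_right_inj]

/-- For every odd `m ≥ 3`, the assignment `ρ_1 ↦ σ`, `ρ_2 ↦ στ` extends to a group
isomorphism from `B(m)` onto the dihedral Artin–Tits group `B(I_2(m))`. -/
theorem stmt19 (m : ℕ) (hm : 3 ≤ m) (hodd : Odd m) :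
    ∃ e : PresentedGroup (BmRels m) ≃* PresentedGroup (DihedralArtinRels m),
      e (PresentedGroup.of 0) = PresentedGroup.of 0 ∧
      e (PresentedGroup.of 1) =
        (PresentedGroup.of 0 : PresentedGroup (DihedralArtinRels m)) *
          PresentedGroup.of 1 := by
  obtain ⟨k, rfl⟩ := hodd
  have h1 : (2 * k + 1 - 1) / 2 = k := by omega
  have h2 : (2 * k + 1 + 1) / 2 = k + 1 := by omega
  let s : PresentedGroup (DihedralArtinRels (2 * k + 1)) := PresentedGroup.of 0
  let t : PresentedGroup (DihedralArtinRels (2 * k + 1)) := PresentedGroup.of 1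
  let a : PresentedGroup (BmRels (2 * k + 1)) := PresentedGroup.of 0
  let b : PresentedGroup (BmRels (2 * k + 1)) := PresentedGroup.of 1
  have hst : (s * t) ^ k * s = (t * s) ^ k * t := by
    have h := PresentedGroup.one_of_mem (rels := DihedralArtinRels (2 * k + 1))
      (Set.mem_singleton _)
    rw [map_mul, map_inv, mul_inv_eq_one, h1] at h
    simp only [map_mul, map_pow] at h
    exact h
  have hab : a * b ^ k * a = b ^ (k + 1) := by
    have h := PresentedGroup.one_of_mem (rels := BmRels (2 * k + 1))
      (Set.mem_singleton _)
    rw [map_mul, map_inv, mul_inv_eq_one, h1, h2] at h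
    simp only [map_mul, map_pow] at h
    exact h
  have hf : ∀ r ∈ BmRels (2 * k + 1), FreeGroup.lift ![s, s * t] r = 1 := by
    rintro r rfl
    rw [map_mul, map_inv, mul_inv_eq_one, h1, h2]
    simpa using (aux_iff s t k).2 hst
  have hg : ∀ r ∈ DihedralArtinRels (2 * k + 1), FreeGroup.lift ![a, a⁻¹ * b] r = 1 := by
    rintro r rfl
    rw [map_mul, map_inv, mul_inv_eq_one, h1]
    have h := (aux_iff a (a⁻¹ * b) k).1 (by rw [mul_inv_cancel_left]; exact hab)
    simp only [map_mul, map_pow, FreeGroup.lift_apply_of]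
    exact h
  let f := PresentedGroup.toGroup hf
  let g := PresentedGroup.toGroup hg
  have f0 : f a = s := PresentedGroup.toGroup.of hf
  have f1 : f b = s * t := PresentedGroup.toGroup.of hf
  have g0 : g s = a := PresentedGroup.toGroup.of hg
  have g1 : g t = a⁻¹ * b := PresentedGroup.toGroup.of hg
  have hgf : g.comp f = MonoidHom.id _ := by
    ext i
    fin_cases i
    · change g (f a) = a
      rw [f0, g0]
    · change g (f b) = b
      rw [f1, map_mul, g0, g1, mul_inv_cancel_left]
  have hfg : f.comp g = MonoidHom.id _ := by
    ext i
    fin_cases i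
    · change f (g s) = s
      rw [g0, f0]
    · change f (g t) = t
      rw [g1, map_mul, map_inv, f0, f1, inv_mul_cancel_left]
  exact ⟨MonoidHom.toMulEquiv f g hgf hfg, f0, f1⟩
end
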